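/- arXiv:1401.7582 — 2 statements merged into one kernel-verified Lean document; each statement's English description precedes it below -/
import Mathlib

section
/- Let μ and μ' be two quasi-stationary Markov measures on K_N, associated to (λ, T) and (λ', T') respectively. Suppose that for every i,j ∈ Z_N, Σ_{n=1}^∞ |T^(n)_{i,j} − T'^(n)_{i,j}| < ∞. Then the measures μ and μ' are equivalent (mutually absolutely continuous). -/
open MeasureTheory Filter Finset

/-- `IsMarkov μ l T` means that `μ` is the Markov measure on `K_N = ℕ → Fin N`
associated to the probability vector `l` and the sequence of transition matrices `T`
(with `T n` playing the role of `T^(n+1)` of the paper, and words indexed from `0`):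
for every cylinder set determined by the first `n + 1` letters,
`μ(C(w₀ … w_n)) = l_{w₀} T^(1)_{w₀,w₁} ⋯ T^(n)_{w_{n-1},w_n}`. -/
def IsMarkov {N : ℕ} (μ : Measure (ℕ → Fin N)) (l : Fin N → ℝ)
    (T : ℕ → Matrix (Fin N) (Fin N) ℝ) : Prop :=
  ∀ (n : ℕ) (w : ℕ → Fin N),
    μ {x | ∀ k ≤ n, x k = w k} =
      ENNReal.ofReal (l (w 0) * ∏ k ∈ Finset.range n, T k (w k) (w (k + 1)))

/-- Domination on a ring of sets generating the σ-algebra implies domination of finite measures. -/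
lemma measure_le_of_le_on_isSetRing {α : Type*} {mα : MeasurableSpace α} {μ ν : Measure α}
    [IsFiniteMeasure μ] [IsFiniteMeasure ν] {R : Set (Set α)} (hR : IsSetRing R)
    (huniv : Set.univ ∈ R) (hgen : mα = MeasurableSpace.generateFrom R)
    (h : ∀ t ∈ R, μ t ≤ ν t) : μ ≤ ν := by
  refine Measure.le_iff.2 fun s hs => ENNReal.le_of_forall_pos_le_add fun ε hε _ => ?_
  obtain ⟨t, ht, hts⟩ := exists_measure_symmDiff_lt_of_generateFrom_isSetRing (μ := μ + ν) hR
    ⟨{Set.univ}, Set.countable_singleton _, by simpa using huniv, by simp⟩ hgen hs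
    (ε := ε) (by exact_mod_cast hε)
  calc μ s ≤ μ (t ∪ s \ t) := measure_mono fun x hx => by by_cases hxt : x ∈ t <;> simp [hx, hxt]
    _ ≤ μ t + μ (s \ t) := measure_union_le _ _
    _ ≤ ν t + μ (s \ t) := add_le_add_left (h t ht) _
    _ ≤ ν (s ∪ t \ s) + μ (s \ t) := by
      gcongr
      exact fun x hx => by by_cases hxs : x ∈ s <;> simp [hx, hxs]
    _ ≤ ν s + ν (t \ s) + μ (s \ t) := by gcongr; exact measure_union_le _ _
    _ = ν s + (μ (s \ t) + ν (t \ s)) := by ring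
    _ ≤ ν s + (μ (symmDiff t s) + ν (symmDiff t s)) := by
      gcongr
      · exact Set.subset_union_right
      · exact Set.subset_union_left
    _ ≤ ν s + ε := by gcongr; exact hts.le

/-- Domination on initial-word cylinders implies domination of finite measures on sequences. -/
lemma measure_le_of_le_on_initial_cylinders {A : Type*} [Finite A] [MeasurableSpace A]
    [MeasurableSingletonClass A] {μ ν : Measure (ℕ → A)}
    [IsFiniteMeasure μ] [IsFiniteMeasure ν]
    (h : ∀ (n : ℕ) (w : ℕ → A), μ {x | ∀ k ≤ n, x k = w k} ≤ ν {x | ∀ k ≤ n, x k = w k}) :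
    μ ≤ ν := by
  refine measure_le_of_le_on_isSetRing (R := measurableCylinders fun _ : ℕ => A)
    isSetRing_measurableCylinders (univ_mem_measurableCylinders _)
    generateFrom_measurableCylinders.symm fun t ht => ?_
  rw [measurableCylinders_nat] at ht
  simp only [Set.mem_iUnion, Set.mem_singleton_iff, exists_prop] at ht
  obtain ⟨n, S, -, rfl⟩ := ht
  have hmeas : ∀ v ∈ S, MeasurableSet ((Finset.Iic n).restrict (π := fun _ : ℕ => A) ⁻¹' {v}) :=
    fun v _ => Finset.measurable_restrict _ (measurableSet_singleton v)
  unfold cylinder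
  rw [← tsum_measure_preimage_singleton S.to_countable hmeas,
    ← tsum_measure_preimage_singleton S.to_countable hmeas]
  refine ENNReal.tsum_le_tsum fun v => ?_
  have hv : (Finset.Iic n).restrict (π := fun _ : ℕ => A) ⁻¹' {v.1} =
      {x | ∀ k ≤ n, x k = v.1 ⟨min k n, Finset.mem_Iic.2 (min_le_right _ _)⟩} := by
    ext x
    simp only [Set.mem_preimage, Set.mem_singleton_iff, funext_iff, Subtype.forall,
      Finset.mem_Iic, Finset.restrict, Set.mem_ofPred_eq]
    refine forall₂_congr fun k hk => ?_
    simp [min_eq_left hk]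
  rw [hv]
  exact h n _

/-- A positive sequence whose consecutive ratios are summably close to `1` is bounded below. -/
lemma exists_pos_le_of_summable_ratio {a : ℕ → ℝ} (ha : ∀ n, 0 < a n)
    (hs : Summable fun n => |a n / a (n + 1) - 1|) : ∃ δ > 0, ∀ n, δ ≤ a n := by
  refine ⟨a 0 * Real.exp (-∑' n, |a n / a (n + 1) - 1|), mul_pos (ha 0) (Real.exp_pos _),
    fun n => ?_⟩
  have key : ∀ n, a 0 ≤ a n * Real.exp (∑ k ∈ Finset.range n, |a k / a (k + 1) - 1|) := by
    intro n
    induction n with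
    | zero => simp
    | succ n ih =>
      have h1 : a n / a (n + 1) ≤ Real.exp |a n / a (n + 1) - 1| := by
        linarith [le_abs_self (a n / a (n + 1) - 1), Real.add_one_le_exp |a n / a (n + 1) - 1|]
      rw [div_le_iff₀ (ha _)] at h1
      rw [Finset.sum_range_succ, Real.exp_add]
      calc a 0 ≤ a n * Real.exp (∑ k ∈ Finset.range n, |a k / a (k + 1) - 1|) := ih
        _ ≤ (Real.exp |a n / a (n + 1) - 1| * a (n + 1)) *
            Real.exp (∑ k ∈ Finset.range n, |a k / a (k + 1) - 1|) := by gcongr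
        _ = _ := by ring
  rw [Real.exp_neg, ← div_eq_mul_inv, div_le_iff₀ (Real.exp_pos _)]
  refine (key n).trans (mul_le_mul_of_nonneg_left (Real.exp_le_exp.2 ?_) (ha n).le)
  exact hs.sum_le_tsum _ fun _ _ => abs_nonneg _

/-- Summability of a nonnegative function of consecutive letters along every path gives
summability for every fixed pair of letters. -/
lemma summable_pair_of_summable_path {A : Type*} {f : ℕ → A → A → ℝ} (hf : ∀ n i j, 0 ≤ f n i j)
    (h : ∀ x : ℕ → A, Summable fun n => f n (x n) (x (n + 1))) (i j : A) :
    Summable fun n => f n i j := by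
  refine ((h fun n => if Even n then i else j).add
    (h fun n => if Even n then j else i)).of_nonneg_of_le (fun n => hf _ _ _) fun n => ?_
  by_cases hn : Even n <;> simp [hn, Nat.even_add_one, hf]

/-- Path products of transition probabilities are comparable up to a uniform constant when the
transition matrices are summably close and the second family is bounded below. -/
lemma exists_prod_le_mul_prod {A : Type*} [Fintype A] {T T' : ℕ → A → A → ℝ}
    (hT : ∀ n i j, 0 < T n i j) (hT' : ∀ n i j, 0 < T' n i j)
    (hlow : ∀ i j, ∃ δ > 0, ∀ n, δ ≤ T' n i j)
    (hdiff : ∀ i j, Summable fun n => |T n i j - T' n i j|) :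
    ∃ C > 0, ∀ (n : ℕ) (w : ℕ → A), ∏ k ∈ Finset.range n, T k (w k) (w (k + 1)) ≤
      C * ∏ k ∈ Finset.range n, T' k (w k) (w (k + 1)) := by
  choose δ hδ hle using hlow
  set e : ℕ → ℝ := fun n => ∑ i, ∑ j, |T n i j - T' n i j| / δ i j with he
  have hnn : ∀ n i j, 0 ≤ |T n i j - T' n i j| / δ i j := fun n i j =>
    div_nonneg (abs_nonneg _) (hδ i j).le
  have hsum : Summable e :=
    summable_sum fun i _ => summable_sum fun j _ => (hdiff i j).div_const _
  have hstep : ∀ n i j, T n i j ≤ Real.exp (e n) * T' n i j := by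
    intro n i j
    have h1 : |T n i j - T' n i j| / δ i j ≤ e n :=
      (Finset.single_le_sum (f := fun j => |T n i j - T' n i j| / δ i j)
        (fun j _ => hnn n i j) (Finset.mem_univ j)).trans
      (Finset.single_le_sum (f := fun i => ∑ j, |T n i j - T' n i j| / δ i j)
        (fun i _ => Finset.sum_nonneg fun j _ => hnn n i j) (Finset.mem_univ i))
    have h2 : |T n i j - T' n i j| ≤ e n * T' n i j := by
      calc |T n i j - T' n i j| = |T n i j - T' n i j| / δ i j * δ i j :=
            (div_mul_cancel₀ _ (hδ i j).ne').symm
        _ ≤ e n * T' n i j :=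
          mul_le_mul h1 (hle i j n) (hδ i j).le ((hnn n i j).trans h1)
    have h3 := mul_le_mul_of_nonneg_right (Real.add_one_le_exp (e n)) (hT' n i j).le
    linarith [le_abs_self (T n i j - T' n i j)]
  refine ⟨Real.exp (∑' n, e n), Real.exp_pos _, fun n w => ?_⟩
  have hprod : 0 ≤ ∏ k ∈ Finset.range n, T' k (w k) (w (k + 1)) :=
    Finset.prod_nonneg fun k _ => (hT' _ _ _).le
  calc ∏ k ∈ Finset.range n, T k (w k) (w (k + 1))
      ≤ ∏ k ∈ Finset.range n, Real.exp (e k) * T' k (w k) (w (k + 1)) :=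
        Finset.prod_le_prod (fun k _ => (hT _ _ _).le) fun k _ => hstep _ _ _
    _ = Real.exp (∑ k ∈ Finset.range n, e k) * ∏ k ∈ Finset.range n, T' k (w k) (w (k + 1)) := by
        rw [Finset.prod_mul_distrib, Real.exp_sum]
    _ ≤ _ := by
        gcongr
        exact hsum.sum_le_tsum _ fun k _ =>
          Finset.sum_nonneg fun i _ => Finset.sum_nonneg fun j _ => hnn k i j

/-- One-sided absolute continuity: only the dominating Markov measure needs to be
quasi-stationary. -/
lemma IsMarkov.absolutelyContinuous_of_summable_diff {N : ℕ} {l l' : Fin N → ℝ}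
    {T T' : ℕ → Matrix (Fin N) (Fin N) ℝ} (hl : ∀ i, 0 < l i) (hl' : ∀ i, 0 < l' i)
    (hpos : ∀ n i j, 0 < T n i j) (hpos' : ∀ n i j, 0 < T' n i j)
    {μ μ' : Measure (ℕ → Fin N)} [IsFiniteMeasure μ] [IsFiniteMeasure μ']
    (hμ : IsMarkov μ l T) (hμ' : IsMarkov μ' l' T')
    (hqs' : ∀ x : ℕ → Fin N,
      Summable fun n => |T' n (x n) (x (n + 1)) / T' (n + 1) (x n) (x (n + 1)) - 1|)
    (hdiff : ∀ i j : Fin N, Summable fun n => |T n i j - T' n i j|) : μ ≪ μ' := by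
  have hlow : ∀ i j, ∃ δ > 0, ∀ n, δ ≤ T' n i j := fun i j =>
    exists_pos_le_of_summable_ratio (fun n => hpos' n i j)
      (summable_pair_of_summable_path (f := fun n i j => |T' n i j / T' (n + 1) i j - 1|)
        (fun _ _ _ => abs_nonneg _) hqs' i j)
  obtain ⟨C, hC, hprod⟩ := exists_prod_le_mul_prod hpos hpos' hlow hdiff
  set D : ℝ := ∑ i, l i / l' i
  have hD : ∀ i, l i ≤ D * l' i := fun i => (div_le_iff₀ (hl' i)).1
    (Finset.single_le_sum (f := fun i => l i / l' i)
      (fun i _ => (div_pos (hl i) (hl' i)).le) (Finset.mem_univ i))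
  have hD0 : 0 ≤ D := Finset.sum_nonneg fun i _ => (div_pos (hl i) (hl' i)).le
  have hle : μ ≤ (D * C).toNNReal • μ' := by
    refine measure_le_of_le_on_initial_cylinders fun n w => ?_
    rw [Measure.smul_apply, hμ n w, hμ' n w, ENNReal.smul_def, smul_eq_mul]
    change _ ≤ ENNReal.ofReal (D * C) * _
    rw [← ENNReal.ofReal_mul (by positivity)]
    refine ENNReal.ofReal_le_ofReal ?_
    calc l (w 0) * ∏ k ∈ Finset.range n, T k (w k) (w (k + 1))
        ≤ (D * l' (w 0)) * (C * ∏ k ∈ Finset.range n, T' k (w k) (w (k + 1))) :=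
          mul_le_mul (hD _) (hprod n w) (Finset.prod_nonneg fun k _ => (hpos _ _ _).le)
            (mul_nonneg hD0 (hl' _).le)
      _ = _ := by ring
  exact (Measure.absolutelyContinuous_of_le hle).trans (Measure.smul_absolutelyContinuous)

/-- If two quasi-stationary Markov measures `μ, μ'` satisfy
`Σ_{n=1}^∞ |T^(n)_{i,j} − T'^(n)_{i,j}| < ∞` for all `i, j`, then `μ` and `μ'` are
equivalent. -/
theorem markov_equivalent_of_summable_diff (N : ℕ) (hN : 2 ≤ N)
    (l l' : Fin N → ℝ) (T T' : ℕ → Matrix (Fin N) (Fin N) ℝ)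
    (hl : ∀ i, 0 < l i) (hlsum : ∑ i, l i = 1)
    (hpos : ∀ n i j, 0 < T n i j) (hstoch : ∀ n i, ∑ j, T n i j = 1)
    (hfix : ∀ j, ∑ i, l i * T 0 i j = l j)
    (hl' : ∀ i, 0 < l' i) (hlsum' : ∑ i, l' i = 1)
    (hpos' : ∀ n i j, 0 < T' n i j) (hstoch' : ∀ n i, ∑ j, T' n i j = 1)
    (hfix' : ∀ j, ∑ i, l' i * T' 0 i j = l' j)
    (μ μ' : Measure (ℕ → Fin N)) [IsProbabilityMeasure μ] [IsProbabilityMeasure μ']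
    (hμ : IsMarkov μ l T) (hμ' : IsMarkov μ' l' T')
    (hqs : ∀ x : ℕ → Fin N,
      Summable fun n => |T n (x n) (x (n + 1)) / T (n + 1) (x n) (x (n + 1)) - 1|)
    (hqs' : ∀ x : ℕ → Fin N,
      Summable fun n => |T' n (x n) (x (n + 1)) / T' (n + 1) (x n) (x (n + 1)) - 1|)
    (hdiff : ∀ i j : Fin N, Summable fun n => |T n i j - T' n i j|) :
    μ ≪ μ' ∧ μ' ≪ μ := by
  refine ⟨hμ.absolutelyContinuous_of_summable_diff hl hl' hpos hpos' hμ' hqs' hdiff,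
    hμ'.absolutelyContinuous_of_summable_diff hl' hl hpos' hpos hμ hqs fun i j => ?_⟩
  simpa only [abs_sub_comm] using hdiff i j
end

section
/- Let μ be a quasi-stationary Markov measure on K_N associated to (λ, T) and suppose additionally that Σ_{n=1}^∞ n|T^(n)_{i,j} − T^(n+1)_{i,j}| < ∞ for all i,j ∈ Z_N. Let T^(∞) be the entrywise limit of the matrices T^(n) (which exists, is row-stochastic, and has positive entries), and let λ_∞ be a positive probability row vector with λ_∞ T^(∞) = λ_∞. Let μ_∞ be the stationary Markov measure associated to λ_∞ and the constant sequence T^(∞), i.e. μ_∞(C(i₁…i_n)) = (λ_∞)_{i₁} T^(∞)_{i₁,i₂} ⋯ T^(∞)_{i_{n−1},i_n}. Then μ and μ_∞ are equivalent (mutually absolutely continuous). -/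
open MeasureTheory Filter Finset

/-- On the one-sided shift space, domination on all cylinders implies absolute continuity. -/
theorem absolutelyContinuous_of_cylinder_le {N : ℕ} {μ ν : Measure (ℕ → Fin N)}
    [IsFiniteMeasure ν] {C : ENNReal} (hC : C ≠ ⊤)
    (h : ∀ (n : ℕ) (w : ℕ → Fin N),
      μ {x | ∀ k ≤ n, x k = w k} ≤ C * ν {x | ∀ k ≤ n, x k = w k}) :
    μ ≪ ν := by
  have open_le : ∀ U : Set (ℕ → Fin N), IsOpen U → μ U ≤ C * ν U := by
    intro U hU
    let V : ℕ → Set (ℕ → Fin N) := fun n => {x | {y | ∀ k ≤ n, y k = x k} ⊆ U}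
    have hV_subset : ∀ n, V n ⊆ U := fun n x hx => hx fun k _ => rfl
    have hV_mono : Monotone V := fun m n hmn x hx y hy =>
      hx fun k hk => hy k (hk.trans hmn)
    have hV_union : U = ⋃ n, V n := by
      refine Set.Subset.antisymm (fun x hx => ?_) (Set.iUnion_subset hV_subset)
      obtain ⟨I, u, hu, hsub⟩ := isOpen_pi_iff.mp hU x hx
      refine Set.mem_iUnion.mpr ⟨I.sup id, fun y hy => hsub fun a ha => ?_⟩
      rw [hy a (Finset.le_sup (f := id) ha)]
      exact (hu a ha).2
    have hV_le : ∀ n, μ (V n) ≤ C * ν (V n) := by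
      intro n
      classical
      let p : (ℕ → Fin N) → (Fin (n + 1) → Fin N) := fun x k => x k
      have hp : Measurable p := measurable_pi_lambda _ fun k => measurable_pi_apply _
      have fiber : ∀ x, p ⁻¹' {p x} = {y | ∀ k ≤ n, y k = x k} := by
        intro x
        ext y
        simp only [Set.mem_preimage, Set.mem_singleton_iff, Set.mem_ofPred_eq, funext_iff, p]
        exact ⟨fun hy k hk => hy ⟨k, by omega⟩, fun hy k => hy k (by omega)⟩
      let F : Finset (Fin (n + 1) → Fin N) := Finset.univ.filter fun v => v ∈ p '' V n
      have hF : V n = p ⁻¹' (F : Set _) := by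
        ext x
        simp only [F, Set.mem_preimage, Finset.coe_filter, Finset.mem_univ, true_and,
          Set.mem_ofPred_eq]
        refine ⟨fun hx => ⟨x, hx, rfl⟩, ?_⟩
        rintro ⟨z, hz, hzx⟩ y hy
        refine hz fun k hk => (hy k hk).trans ?_
        exact (congrFun hzx ⟨k, by omega⟩).symm
      rw [hF, ← sum_measure_preimage_singleton F fun v _ => hp (measurableSet_singleton v),
        ← sum_measure_preimage_singleton F fun v _ => hp (measurableSet_singleton v),
        Finset.mul_sum]
      refine Finset.sum_le_sum fun v hv => ?_
      obtain ⟨x, -, rfl⟩ := (Finset.mem_filter.mp hv).2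
      rw [fiber]
      exact h n x
    rw [hV_union, hV_mono.measure_iUnion]
    refine iSup_le fun n => (hV_le n).trans ?_
    gcongr
    exact Set.subset_iUnion V n
  intro s hs
  have key : ∀ ε : ENNReal, 0 < ε → μ s ≤ C * ε := by
    intro ε hε
    obtain ⟨U, hsU, hU, hlt⟩ := s.exists_isOpen_lt_of_lt (μ := ν) ε (by rwa [hs])
    exact (measure_mono hsU).trans ((open_le U hU).trans (by gcongr))
  by_contra hne
  obtain ⟨δ, hδ, hlt⟩ := ENNReal.exists_pos_mul_lt hC hne
  exact absurd (key δ hδ) (not_le.mpr (by rwa [mul_comm]))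

/-- A Markov measure is absolutely continuous with respect to another one whose initial vector
and transition matrices dominate the given ones up to summable relative errors. -/
theorem IsMarkov.absolutelyContinuous {N : ℕ} {μ ν : Measure (ℕ → Fin N)} [IsFiniteMeasure ν]
    {l l' : Fin N → ℝ} {T T' : ℕ → Matrix (Fin N) (Fin N) ℝ}
    (hμ : IsMarkov μ l T) (hν : IsMarkov ν l' T')
    (hl' : ∀ i, 0 < l' i) (hl : ∀ i, 0 ≤ l i)
    (hT : ∀ n i j, 0 ≤ T n i j) (hT' : ∀ n i j, 0 ≤ T' n i j)
    {d : ℕ → ℝ} (hd : Summable d) (hd0 : ∀ n, 0 ≤ d n)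
    (hle : ∀ n i j, T n i j ≤ (1 + d n) * T' n i j) : μ ≪ ν := by
  let A : ℝ := ∑ i, l i / l' i
  have hA : 0 ≤ A := Finset.sum_nonneg fun i _ => div_nonneg (hl i) (hl' i).le
  have hlA : ∀ i, l i ≤ A * l' i := fun i => by
    rw [← div_le_iff₀ (hl' i)]
    exact Finset.single_le_sum (f := fun i => l i / l' i)
      (fun i _ => div_nonneg (hl i) (hl' i).le) (Finset.mem_univ i)
  refine absolutelyContinuous_of_cylinder_le
    (C := ENNReal.ofReal (A * Real.exp (∑' n, d n))) ENNReal.ofReal_ne_top fun n w => ?_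
  rw [hμ, hν, ← ENNReal.ofReal_mul (by positivity)]
  refine ENNReal.ofReal_le_ofReal ?_
  have hprod' : 0 ≤ ∏ k ∈ Finset.range n, T' k (w k) (w (k + 1)) :=
    Finset.prod_nonneg fun k _ => hT' _ _ _
  have hprod : ∏ k ∈ Finset.range n, T k (w k) (w (k + 1)) ≤
      Real.exp (∑' n, d n) * ∏ k ∈ Finset.range n, T' k (w k) (w (k + 1)) := by
    calc ∏ k ∈ Finset.range n, T k (w k) (w (k + 1))
        ≤ ∏ k ∈ Finset.range n, Real.exp (d k) * T' k (w k) (w (k + 1)) := by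
          refine Finset.prod_le_prod (fun k _ => hT _ _ _) fun k _ => (hle _ _ _).trans ?_
          refine mul_le_mul_of_nonneg_right ?_ (hT' _ _ _)
          linarith [Real.add_one_le_exp (d k)]
      _ = Real.exp (∑ k ∈ Finset.range n, d k) *
            ∏ k ∈ Finset.range n, T' k (w k) (w (k + 1)) := by
          rw [Finset.prod_mul_distrib, Real.exp_sum]
      _ ≤ _ := by
          gcongr
          exact hd.sum_le_tsum _ fun k _ => hd0 k
  calc l (w 0) * ∏ k ∈ Finset.range n, T k (w k) (w (k + 1))
      ≤ (A * l' (w 0)) *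
          (Real.exp (∑' n, d n) * ∏ k ∈ Finset.range n, T' k (w k) (w (k + 1))) :=
        mul_le_mul (hlA _) hprod (Finset.prod_nonneg fun k _ => hT _ _ _)
          (mul_nonneg hA (hl' _).le)
    _ = _ := by ring

/-- A positive sequence whose consecutive ratios are summably close to `1` is bounded away
from `0`. -/
theorem exists_pos_le_of_summable_ratio_s17 {f : ℕ → ℝ} (hf : ∀ n, 0 < f n)
    (h : Summable fun n => |f n / f (n + 1) - 1|) : ∃ c, 0 < c ∧ ∀ n, c ≤ f n := by
  have hstep : ∀ n, f 0 ≤ Real.exp (∑ k ∈ Finset.range n, |f k / f (k + 1) - 1|) * f n := by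
    intro n
    induction n with
    | zero => simp
    | succ n ih =>
      have hn : f n ≤ Real.exp |f n / f (n + 1) - 1| * f (n + 1) := by
        rw [← div_le_iff₀ (hf _)]
        linarith [le_abs_self (f n / f (n + 1) - 1),
          Real.add_one_le_exp |f n / f (n + 1) - 1|]
      rw [Finset.sum_range_succ, Real.exp_add, mul_assoc]
      exact ih.trans (mul_le_mul_of_nonneg_left hn (Real.exp_pos _).le)
  refine ⟨f 0 / Real.exp (∑' n, |f n / f (n + 1) - 1|), div_pos (hf 0) (Real.exp_pos _),
    fun n => ?_⟩
  rw [div_le_iff₀' (Real.exp_pos _)]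
  refine (hstep n).trans (mul_le_mul_of_nonneg_right ?_ (hf n).le)
  exact Real.exp_le_exp.mpr (h.sum_le_tsum _ fun k _ => abs_nonneg _)

/-- If the increments of a convergent sequence are summable with weight `n + 1`, then the
distances to the limit are summable. -/
theorem summable_abs_sub_of_summable_weighted {t : ℕ → ℝ} {a : ℝ}
    (ht : Tendsto t atTop (nhds a))
    (h : Summable fun n : ℕ => ((n : ℝ) + 1) * |t n - t (n + 1)|) :
    Summable fun n => |t n - a| := by
  have hstep : ∀ M : ℕ, ∑ k ∈ Finset.range M, |t k - t M| ≤
      ∑ n ∈ Finset.range M, ((n : ℝ) + 1) * |t n - t (n + 1)| := by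
    intro M
    induction M with
    | zero => simp
    | succ M ih =>
      calc ∑ k ∈ Finset.range (M + 1), |t k - t (M + 1)|
          ≤ ∑ k ∈ Finset.range (M + 1), (|t k - t M| + |t M - t (M + 1)|) :=
            Finset.sum_le_sum fun k _ => abs_sub_le _ _ _
        _ = ∑ k ∈ Finset.range M, |t k - t M| + ((M : ℝ) + 1) * |t M - t (M + 1)| := by
            rw [Finset.sum_add_distrib, Finset.sum_range_succ]
            simp
        _ ≤ _ := by
            rw [Finset.sum_range_succ _ M]
            linarith
  refine summable_of_sum_range_le (c := ∑' n : ℕ, ((n : ℝ) + 1) * |t n - t (n + 1)|)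
    (fun n => abs_nonneg _) fun m => ?_
  have hlim : Tendsto (fun M => ∑ k ∈ Finset.range m, |t k - t M|) atTop
      (nhds (∑ k ∈ Finset.range m, |t k - a|)) :=
    tendsto_finsetSum _ fun k _ => (tendsto_const_nhds.sub ht).abs
  refine le_of_tendsto hlim (eventually_atTop.mpr ⟨m, fun M hM => ?_⟩)
  calc ∑ k ∈ Finset.range m, |t k - t M|
      ≤ ∑ k ∈ Finset.range M, |t k - t M| :=
        Finset.sum_le_sum_of_subset_of_nonneg (Finset.range_mono hM) fun k _ _ => abs_nonneg _
    _ ≤ _ := (hstep M).trans (h.sum_le_tsum _ fun k _ => by positivity)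

/-- Quasi-stationarity along all words gives summability entrywise. -/
theorem summable_entry_of_forall_word {α : Type*} {g : ℕ → α → α → ℝ}
    (hg : ∀ n i j, 0 ≤ g n i j)
    (h : ∀ x : ℕ → α, Summable fun n => g n (x n) (x (n + 1))) (i j : α) :
    Summable fun n => g n i j := by
  refine Summable.of_nonneg_of_le (fun n => hg n i j) (fun n => ?_)
    ((h fun n => if Even n then i else j).add (h fun n => if Even n then j else i))
  by_cases hn : Even n
  · simpa [hn, Nat.even_add_one] using hg n j i
  · simpa [hn, Nat.even_add_one] using hg n j i

/-- Let `μ` be a quasi-stationary Markov measure associated to `(λ, T)` with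
`Σ_{n=1}^∞ n |T^(n)_{i,j} − T^(n+1)_{i,j}| < ∞` (here `T n = T^(n+1)`, so the weight `n`
becomes `n + 1`). Let `T^(∞)` be the entrywise limit of the `T^(n)`, `λ_∞` a positive
probability row vector with `λ_∞ T^(∞) = λ_∞`, and `μ_∞` the stationary Markov measure
associated to `(λ_∞, T^(∞))`. Then `μ` and `μ_∞` are equivalent. -/
theorem markov_equivalent_stationary (N : ℕ) (hN : 2 ≤ N)
    (l : Fin N → ℝ) (T : ℕ → Matrix (Fin N) (Fin N) ℝ)
    (hl : ∀ i, 0 < l i) (hlsum : ∑ i, l i = 1)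
    (hpos : ∀ n i j, 0 < T n i j) (hstoch : ∀ n i, ∑ j, T n i j = 1)
    (hfix : ∀ j, ∑ i, l i * T 0 i j = l j)
    (μ : Measure (ℕ → Fin N)) [IsProbabilityMeasure μ]
    (hμ : IsMarkov μ l T)
    (hqs : ∀ x : ℕ → Fin N,
      Summable fun n => |T n (x n) (x (n + 1)) / T (n + 1) (x n) (x (n + 1)) - 1|)
    (hsum : ∀ i j : Fin N, Summable fun n : ℕ => ((n : ℝ) + 1) * |T n i j - T (n + 1) i j|)
    (Tinf : Matrix (Fin N) (Fin N) ℝ)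
    (hTinf : ∀ i j, Tendsto (fun n => T n i j) atTop (nhds (Tinf i j)))
    (linf : Fin N → ℝ)
    (hlinf : ∀ i, 0 < linf i) (hlinfsum : ∑ i, linf i = 1)
    (hlinffix : ∀ j, ∑ i, linf i * Tinf i j = linf j)
    (μinf : Measure (ℕ → Fin N)) [IsProbabilityMeasure μinf]
    (hμinf : IsMarkov μinf linf (fun _ => Tinf)) :
    μ ≪ μinf ∧ μinf ≪ μ := by
  have hbound : ∀ i j, ∃ c, 0 < c ∧ ∀ n, c ≤ T n i j := fun i j =>
    exists_pos_le_of_summable_ratio_s17 (fun n => hpos n i j)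
      (summable_entry_of_forall_word (g := fun n i j => |T n i j / T (n + 1) i j - 1|)
        (fun _ _ _ => abs_nonneg _) hqs i j)
  choose c hc hcT using hbound
  have hcinf : ∀ i j, c i j ≤ Tinf i j := fun i j =>
    ge_of_tendsto' (hTinf i j) fun n => hcT i j n
  let d : ℕ → ℝ := fun n => ∑ i, ∑ j, |T n i j - Tinf i j| / c i j
  have hterm : ∀ n i j, 0 ≤ |T n i j - Tinf i j| / c i j := fun n i j =>
    div_nonneg (abs_nonneg _) (hc i j).le
  have hd0 : ∀ n, 0 ≤ d n := fun n =>
    Finset.sum_nonneg fun i _ => Finset.sum_nonneg fun j _ => hterm n i j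
  have hd : Summable d := summable_sum fun i _ => summable_sum fun j _ =>
    (summable_abs_sub_of_summable_weighted (hTinf i j) (hsum i j)).div_const _
  have habs : ∀ n i j, |T n i j - Tinf i j| ≤ d n * c i j := fun n i j => by
    rw [← div_le_iff₀ (hc i j)]
    exact (Finset.single_le_sum (f := fun j => |T n i j - Tinf i j| / c i j)
        (fun j _ => hterm n i j) (Finset.mem_univ j)).trans
      (Finset.single_le_sum (f := fun i => ∑ j, |T n i j - Tinf i j| / c i j)
        (fun i _ => Finset.sum_nonneg fun j _ => hterm n i j) (Finset.mem_univ i))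
  have hT0 : ∀ n i j, 0 ≤ T n i j := fun n i j => (hpos n i j).le
  have hTinf0 : ∀ (_ : ℕ) i j, 0 ≤ Tinf i j := fun _ i j => (hc i j).le.trans (hcinf i j)
  refine ⟨hμ.absolutelyContinuous hμinf hlinf (fun i => (hl i).le) hT0 hTinf0 hd hd0 ?_,
    hμinf.absolutelyContinuous hμ hl (fun i => (hlinf i).le) hTinf0 hT0 hd hd0 ?_⟩
  · intro n i j
    linarith [mul_le_mul_of_nonneg_left (hcinf i j) (hd0 n), habs n i j,
      le_abs_self (T n i j - Tinf i j)]
  · intro n i j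
    linarith [mul_le_mul_of_nonneg_left (hcT i j n) (hd0 n), habs n i j,
      neg_abs_le (T n i j - Tinf i j)]
end
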